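/- Let n ≥ 3 be odd, let j be an odd integer with 1 ≤ j ≤ n−2, set θ = π·j/(2n), and let r > 0. Let x = D(r) and let y be the 2×2 real matrix with entries a, b (first row) and c, d (second row), where a = (−e^{-r}·cosh(r) + cos(2θ))/sinh(r), d = (e^r·cosh(r) − cos(2θ))/sinh(r), and b·c = −4·sin²(θ)·(sin²(θ) + sinh²(r))/sinh²(r). Then x^{-2n}·(x·y)^n equals the diagonal 2×2 matrix with diagonal entries −e^{-2nr} and −e^{2nr}. -/

import Mathlib

/-- Powers of an element satisfying `M ^ 2 = 2 cos φ • M - 1`, in Chebyshev form. -/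
lemma sin_smul_pow_succ {A : Type*} [Ring A] [Algebra ℝ A] (M : A) (φ : ℝ)
    (hM : M * M = (2 * Real.cos φ) • M - 1) (k : ℕ) :
    Real.sin φ • M ^ (k + 1) = Real.sin ((k + 1) * φ) • M - Real.sin (k * φ) • (1 : A) := by
  induction k with
  | zero => simp
  | succ k ih =>
    have hsin : Real.sin ((k + 1 + 1) * φ) =
        2 * Real.cos φ * Real.sin ((k + 1) * φ) - Real.sin (k * φ) := by
      have h₁ : ((k : ℝ) + 1 + 1) * φ = (k + 1) * φ + φ := by ring
      have h₂ : (k : ℝ) * φ = (k + 1) * φ - φ := by ring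
      rw [h₁, h₂, Real.sin_add, Real.sin_sub]
      ring
    rw [pow_succ, ← smul_mul_assoc, ih, sub_mul, smul_mul_assoc, hM, smul_mul_assoc, one_mul]
    push_cast
    rw [hsin]
    module

lemma Matrix.mul_self_fin_two {R : Type*} [CommRing R] (M : Matrix (Fin 2) (Fin 2) R) :
    M * M = M.trace • M - M.det • (1 : Matrix (Fin 2) (Fin 2) R) := by
  ext i k
  fin_cases i <;> fin_cases k <;>
    simp [Matrix.mul_apply, Matrix.trace_fin_two, Matrix.det_fin_two] <;> ring

/-- A real unimodular matrix with trace `2 cos (π j / n)`, where `j` is odd and `0 < j < n`,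
has `n`-th power `-1`. -/
lemma Matrix.pow_eq_neg_one_of_trace_eq_two_cos {n j : ℕ} (hj : Odd j) (hjn : j < n)
    (M : Matrix (Fin 2) (Fin 2) ℝ) (hdet : M.det = 1)
    (htr : M.trace = 2 * Real.cos (Real.pi * j / n)) : M ^ n = -1 := by
  set φ : ℝ := Real.pi * j / n with hφ
  have hn : (0 : ℝ) < n := by exact_mod_cast (Nat.zero_le j).trans_lt hjn
  have hnφ : n * φ = j * Real.pi := by rw [hφ]; field_simp
  have hsin : 0 < Real.sin φ := by
    have hj0 : (0 : ℝ) < j := by exact_mod_cast hj.pos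
    have hjn' : (j : ℝ) < n := by exact_mod_cast hjn
    apply Real.sin_pos_of_pos_of_lt_pi
    · positivity
    · rw [hφ, div_lt_iff₀ hn]
      exact mul_lt_mul_of_pos_left hjn' Real.pi_pos
  obtain ⟨k, rfl⟩ : ∃ k, n = k + 1 := ⟨n - 1, by omega⟩
  push_cast at hnφ
  have hpow := sin_smul_pow_succ M φ (by rw [Matrix.mul_self_fin_two, hdet, htr, one_smul]) k
  have hkφ : (k : ℝ) * φ = j * Real.pi - φ := by linarith
  have hsink : Real.sin (k * φ) = Real.sin φ := by
    rw [hkφ, Real.sin_sub, Real.sin_nat_mul_pi, Real.cos_nat_mul_pi, hj.neg_one_pow]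
    ring
  rw [hnφ, Real.sin_nat_mul_pi, hsink, zero_smul, zero_sub, ← smul_neg] at hpow
  exact smul_right_injective _ hsin.ne' hpow

theorem longitudinal_mapping_value
    (n : ℕ) (hn3 : 3 ≤ n) (hnodd : Odd n)
    (j : ℕ) (hjodd : Odd j) (hj1 : 1 ≤ j) (hjn : j ≤ n - 2)
    (θ : ℝ) (hθ : θ = Real.pi * j / (2 * n))
    (r : ℝ) (hr : 0 < r) (a b c d : ℝ)
    (ha : a = (-Real.exp (-r) * Real.cosh r + Real.cos (2 * θ)) / Real.sinh r)
    (hd : d = (Real.exp r * Real.cosh r - Real.cos (2 * θ)) / Real.sinh r)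
    (hbc : b * c = -(4 * Real.sin θ ^ 2 * (Real.sin θ ^ 2 + Real.sinh r ^ 2))
        / Real.sinh r ^ 2)
    (x y : Matrix (Fin 2) (Fin 2) ℝ)
    (hx : x = !![Real.exp r, 0; 0, Real.exp (-r)])
    (hy : y = !![a, b; c, d]) :
    (x⁻¹) ^ (2 * n) * (x * y) ^ n =
      !![-Real.exp (-(2 * n * r)), 0; 0, -Real.exp (2 * n * r)] := by
  have hs : Real.sinh r ≠ 0 := (Real.sinh_pos_iff.mpr hr).ne'
  have hexp : Real.exp r * Real.exp (-r) = 1 := by rw [← Real.exp_add]; simp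
  have hep : Real.exp r = Real.cosh r + Real.sinh r := (Real.cosh_add_sinh r).symm
  have hem : Real.exp (-r) = Real.cosh r - Real.sinh r := (Real.cosh_sub_sinh r).symm
  have hch : Real.cosh r ^ 2 = Real.sinh r ^ 2 + 1 := Real.cosh_sq r
  have hcos : Real.cos (2 * θ) = 1 - 2 * Real.sin θ ^ 2 := by
    rw [Real.cos_two_mul, Real.cos_sq']; ring
  have hdetx : x.det = 1 := by simpa [hx, Matrix.det_fin_two] using hexp
  have hdety : y.det = 1 := by
    rw [hy, Matrix.det_fin_two_of, hbc, ha, hd, hep, hem, hcos]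
    field_simp
    linear_combination (1 - 4 * Real.sin θ ^ 2 - Real.cosh r ^ 2) * hch
  have htr : (x * y).trace = 2 * Real.cos (Real.pi * j / n) := by
    have hφ : Real.pi * j / n = 2 * θ := by rw [hθ]; field_simp
    rw [hφ, hx, hy, Matrix.trace_fin_two]
    simp only [Matrix.mul_apply, Fin.sum_univ_two, Matrix.of_apply,
      Matrix.cons_val', Matrix.cons_val_zero, Matrix.cons_val_one,
      Matrix.cons_val_fin_one, zero_mul, add_zero, zero_add]
    rw [ha, hd, hep, hem]
    field_simp
    ring
  have hpow : (x * y) ^ n = -1 :=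
    Matrix.pow_eq_neg_one_of_trace_eq_two_cos hjodd (by omega) _
      (by rw [Matrix.det_mul, hdetx, hdety, one_mul]) htr
  have hxinv : x⁻¹ = Matrix.diagonal ![Real.exp (-r), Real.exp r] := by
    apply Matrix.inv_eq_right_inv
    rw [hx]
    ext i k
    fin_cases i <;> fin_cases k <;> simp [hexp, mul_comm]
  rw [hpow, hxinv, Matrix.diagonal_pow]
  ext i k
  fin_cases i <;> fin_cases k <;> simp [← Real.exp_nat_mul]
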